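/- The series Σ_{k=1}^{∞} arctan(1 / (F_{2k+1}·√5)) converges and its sum equals arctan(1 / φ²). -/

import Mathlib

open Real Finset

/-- The Lucas numbers: `L 0 = 2`, `L 1 = 1`, `L (n+2) = L (n+1) + L n`. -/
def lucas : ℕ → ℕ
  | 0 => 2
  | 1 => 1
  | n + 2 => lucas (n + 1) + lucas n

/-- The golden ratio `φ = (1 + √5)/2`. -/
noncomputable def phi : ℝ := (1 + Real.sqrt 5) / 2

theorem phi_eq_goldenRatio : phi = Real.goldenRatio := rfl

theorem fib_odd_mul_sqrt_five (m : ℕ) :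
    (Nat.fib (2 * m + 1) : ℝ) * √5 = phi ^ (2 * m + 1) + (phi ^ (2 * m + 1))⁻¹ := by
  rw [Real.coe_fib_eq, div_mul_cancel₀ _ (by positivity), phi_eq_goldenRatio, ← inv_pow,
    Real.inv_goldenRatio, Odd.neg_pow ⟨m, rfl⟩, sub_eq_add_neg]

theorem arctan_one_div_fib_odd (m : ℕ) :
    arctan (1 / ((Nat.fib (2 * m + 1) : ℝ) * √5)) =
      arctan (1 / phi ^ (2 * m)) - arctan (1 / phi ^ (2 * (m + 1))) := by
  have hpos : 0 < phi := Real.goldenRatio_pos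
  have hsq : phi ^ 2 = phi + 1 := Real.goldenRatio_sq
  have hx : 0 < phi ^ (2 * m) := by positivity
  rw [fib_odd_mul_sqrt_five, sub_eq_add_neg, ← arctan_neg, arctan_add]
  · congr 1
    rw [pow_succ, show 2 * (m + 1) = 2 * m + 2 by ring, pow_add]
    generalize phi ^ (2 * m) = x at hx
    have h₁ : 1 - 1 / x * -(1 / (x * phi ^ 2)) = (x ^ 2 * phi ^ 2 + 1) / (x ^ 2 * phi ^ 2) := by
      field_simp
      ring
    have h₂ : 1 / x + -(1 / (x * phi ^ 2)) = phi / (x * phi ^ 2) := by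
      field_simp
      linarith
    rw [h₁, h₂]
    field_simp
  · have : 0 < 1 / phi ^ (2 * m) * (1 / phi ^ (2 * (m + 1))) := by positivity
    linarith

theorem sum_range_arctan_one_div_fib_odd (n : ℕ) :
    ∑ k ∈ range n, arctan (1 / ((Nat.fib (2 * (k + 1) + 1) : ℝ) * √5)) =
      arctan (1 / phi ^ 2) - arctan (1 / phi ^ (2 * (n + 1))) := by
  simp_rw [arctan_one_div_fib_odd]
  exact sum_range_sub' (fun k => arctan (1 / phi ^ (2 * (k + 1)))) n

theorem tendsto_arctan_one_div_phi_pow :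
    Filter.Tendsto (fun n : ℕ => arctan (1 / phi ^ (2 * (n + 1)))) Filter.atTop (nhds 0) := by
  have hpow : Filter.Tendsto (fun n : ℕ => phi ^ (2 * (n + 1))) Filter.atTop Filter.atTop :=
    (tendsto_pow_atTop_atTop_of_one_lt Real.one_lt_goldenRatio).comp
      (Filter.tendsto_atTop_mono (fun n => by dsimp only [id]; omega) Filter.tendsto_id)
  simpa [Function.comp_def] using
    (continuous_arctan.tendsto 0).comp (tendsto_inv_atTop_zero.comp hpow)

theorem stmt12 :
    HasSum (fun k : ℕ => Real.arctan (1 / ((Nat.fib (2 * (k + 1) + 1) : ℝ) * Real.sqrt 5)))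
      (Real.arctan (1 / phi ^ 2)) := by
  have hnonneg : ∀ k : ℕ, 0 ≤ arctan (1 / ((Nat.fib (2 * (k + 1) + 1) : ℝ) * √5)) :=
    fun k => arctan_nonneg.mpr (by positivity)
  rw [hasSum_iff_tendsto_nat_of_nonneg hnonneg]
  simp_rw [sum_range_arctan_one_div_fib_odd]
  simpa only [sub_zero] using tendsto_arctan_one_div_phi_pow.const_sub (arctan (1 / phi ^ 2))
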